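/- Fix α, τ > 0 and a probability distribution Q on [ℓ]. Let W_τ = {i : Q(i) > (1+α+τ)Q(i-1)} be the set of τ-witnesses. Then the total variation distance from Q to the set of distributions satisfying Q'(k+1) ≤ (1+α)Q'(k) for all k < ℓ is at most ((1+α+τ)/(α+τ)) · Q(W_τ) + τ(1+α)/α². -/

import Mathlib

open Finset

noncomputable def tv {n : ℕ} (D P : Fin n → ℝ) : ℝ := (∑ i, |D i - P i|) / 2

def IsDist {n : ℕ} (D : Fin n → ℝ) : Prop := (∀ i, 0 ≤ D i) ∧ ∑ i, D i = 1

/-- The exponential property `P_α`: `Q (k+1) ≤ (1+α) * Q k` for all `k < ℓ`. -/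
def ExpProp {ℓ : ℕ} (α : ℝ) (Q : Fin ℓ → ℝ) : Prop :=
  ∀ i : Fin ℓ, ∀ h : i.1 + 1 < ℓ, Q ⟨i.1 + 1, h⟩ ≤ (1 + α) * Q i

/-- Predecessor of a nonzero index in `Fin ℓ`. -/
def pred' {ℓ : ℕ} (i : Fin ℓ) : Fin ℓ :=
  ⟨i.1 - 1, Nat.lt_of_le_of_lt (Nat.sub_le _ _) i.2⟩

/-- The amount by which `Q` violates the `P_α` constraint at the step into `j`. -/
noncomputable def expDefect {ℓ : ℕ} (α : ℝ) (Q : Fin ℓ → ℝ) (j : Fin ℓ) : ℝ :=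
  max 0 (Q j - (1 + α) * Q (pred' j))

/-- The mass added at `k` to repair all later violations: the defect at `j` is propagated
backwards with geometric decay. -/
noncomputable def expExcess {ℓ : ℕ} (α : ℝ) (Q : Fin ℓ → ℝ) (k : Fin ℓ) : ℝ :=
  ∑ j : Fin ℓ, if k.1 < j.1 then expDefect α Q j * (1 + α)⁻¹ ^ (j.1 - k.1) else 0

lemma expDefect_nonneg {ℓ : ℕ} (α : ℝ) (Q : Fin ℓ → ℝ) (j : Fin ℓ) : 0 ≤ expDefect α Q j :=
  le_max_left _ _

lemma expExcess_nonneg {ℓ : ℕ} {α : ℝ} (hα : 0 < α) (Q : Fin ℓ → ℝ) (k : Fin ℓ) :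
    0 ≤ expExcess α Q k := by
  refine sum_nonneg fun j _ => ?_
  have := expDefect_nonneg α Q j
  split_ifs <;> positivity

lemma expProp_add_expExcess {ℓ : ℕ} {α : ℝ} (hα : 0 < α) (Q : Fin ℓ → ℝ) :
    ExpProp α fun k => Q k + expExcess α Q k := by
  intro i h
  set s : Fin ℓ := ⟨i.1 + 1, h⟩ with hs
  have hpred : pred' s = i := by ext; simp [pred', hs]
  have hdefect : Q s - (1 + α) * Q i ≤ expDefect α Q s := by
    rw [expDefect, hpred]; exact le_max_right _ _
  have hrec : (1 + α) * expExcess α Q i = expDefect α Q s + expExcess α Q s := by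
    have hsum : expDefect α Q s = ∑ j : Fin ℓ, if j = s then expDefect α Q j else 0 := by simp
    rw [hsum, expExcess, expExcess, ← sum_add_distrib, mul_sum]
    refine sum_congr rfl fun j _ => ?_
    have hval : j = s ↔ j.1 = i.1 + 1 := by rw [Fin.ext_iff]
    rcases lt_trichotomy j.1 (i.1 + 1) with hj | hj | hj
    · rw [if_neg (by omega), if_neg (by omega), if_neg (by simp only [hs]; omega)]; simp
    · rw [if_pos (by omega), if_pos (hval.2 hj), if_neg (by simp only [hs]; omega),
        show j.1 - i.1 = 1 by omega]
      field_simp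
      ring
    · rw [if_pos (by omega), if_neg (by omega), if_pos (by simp only [hs]; omega),
        show j.1 - i.1 = (j.1 - s.1) + 1 by simp only [hs]; omega, pow_succ]
      field_simp
      ring
  change Q s + expExcess α Q s ≤ (1 + α) * (Q i + expExcess α Q i)
  linarith

lemma sum_range_inv_pow_sub_le {α : ℝ} (hα : 0 < α) (n : ℕ) :
    ∑ k ∈ range n, (1 + α)⁻¹ ^ (n - k) ≤ 1 / α := by
  induction n with
  | zero => simp [hα.le]
  | succ n ih =>
    have hstep : ∑ k ∈ range n, (1 + α)⁻¹ ^ (n + 1 - k)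
        = (1 + α)⁻¹ * ∑ k ∈ range n, (1 + α)⁻¹ ^ (n - k) := by
      rw [mul_sum]
      refine sum_congr rfl fun k hk => ?_
      rw [Nat.succ_sub (mem_range.1 hk).le, pow_succ']
    rw [sum_range_succ, hstep]
    calc _ ≤ (1 + α)⁻¹ * (1 / α) + (1 + α)⁻¹ := by
          simp only [Nat.add_sub_cancel_left, pow_one]; gcongr
      _ = 1 / α := by field_simp

lemma sum_expExcess_le {ℓ : ℕ} {α : ℝ} (hα : 0 < α) (Q : Fin ℓ → ℝ) :
    ∑ k, expExcess α Q k ≤ (∑ j, expDefect α Q j) / α := by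
  simp only [expExcess]
  rw [sum_comm, sum_div]
  refine sum_le_sum fun j _ => ?_
  have hrange : ∑ k : Fin ℓ, (if k.1 < j.1 then (1 + α)⁻¹ ^ (j.1 - k.1) else 0)
      = ∑ k ∈ range j.1, (1 + α)⁻¹ ^ (j.1 - k) := by
    rw [Fin.sum_univ_eq_sum_range
      (fun k => if k < j.1 then (1 + α)⁻¹ ^ (j.1 - k) else (0 : ℝ)) ℓ, ← sum_filter]
    congr 1
    ext k
    simp only [mem_filter, mem_range]
    omega
  calc _ = expDefect α Q j * ∑ k : Fin ℓ, (if k.1 < j.1 then (1 + α)⁻¹ ^ (j.1 - k.1) else 0) := by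
        simp only [mul_sum, mul_ite, mul_zero]
    _ ≤ expDefect α Q j * (1 / α) := by
        rw [hrange]
        exact mul_le_mul_of_nonneg_left (sum_range_inv_pow_sub_le hα _) (expDefect_nonneg α Q j)
    _ = _ := by ring

lemma sum_pred'_le {ℓ : ℕ} {Q : Fin ℓ → ℝ} (hQ : ∀ i, 0 ≤ Q i) :
    ∑ j ∈ univ.filter (fun j : Fin ℓ => 0 < j.1), Q (pred' j) ≤ ∑ i, Q i := by
  rw [← sum_image (s := univ.filter fun j : Fin ℓ => 0 < j.1) (g := pred') (f := Q)]
  · exact sum_le_sum_of_subset_of_nonneg (subset_univ _) fun i _ _ => hQ i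
  · intro x hx y hy hxy
    simp only [coe_filter, mem_univ, true_and, Set.mem_ofPred_eq] at hx hy
    simp only [pred', Fin.mk.injEq] at hxy
    ext
    omega

lemma sum_expDefect_le {ℓ : ℕ} {α τ : ℝ} (hα : 0 < α) (hτ : 0 < τ) {Q : Fin ℓ → ℝ}
    (hQ : ∀ i, 0 ≤ Q i) :
    ∑ j, expDefect α Q j ≤
      ∑ i ∈ univ.filter (fun i : Fin ℓ => 0 < i.1 ∧ Q i > (1 + α + τ) * Q (pred' i)), Q i
        + τ * ∑ i, Q i := by
  calc ∑ j, expDefect α Q j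
      ≤ ∑ j : Fin ℓ, ((if 0 < j.1 ∧ Q j > (1 + α + τ) * Q (pred' j) then Q j else 0)
          + τ * if 0 < j.1 then Q (pred' j) else 0) := by
        refine sum_le_sum fun j _ => ?_
        have hj := hQ j
        have hp := hQ (pred' j)
        have hαp := mul_nonneg hα.le hp
        have hτp := mul_nonneg hτ.le hp
        rw [expDefect]
        by_cases h0 : 0 < j.1
        · by_cases hw : Q j > (1 + α + τ) * Q (pred' j)
          · rw [if_pos ⟨h0, hw⟩, if_pos h0]
            exact max_le (by linarith) (by linarith)
          · rw [if_neg (fun h => hw h.2), if_pos h0]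
            exact max_le (by linarith) (by linarith)
        · have hpj : pred' j = j := by ext; simp only [pred']; omega
          rw [if_neg (fun h => h0 h.1), if_neg h0, hpj]
          rw [hpj] at hαp
          exact max_le (by simp) (by linarith)
    _ ≤ _ := by
        rw [sum_add_distrib, ← sum_filter, ← mul_sum, ← sum_filter]
        gcongr
        exact sum_pred'_le hQ

/-- Adding total mass `∑ E` to a distribution and renormalizing moves it by at most `∑ E`. -/
lemma tv_normalize_add_le {n : ℕ} {Q E : Fin n → ℝ} (hQ : IsDist Q) (hE : ∀ i, 0 ≤ E i) :
    tv Q (fun i => (Q i + E i) / (1 + ∑ j, E j)) ≤ ∑ j, E j := by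
  set S := ∑ j, E j with hS
  have hS0 : 0 ≤ S := sum_nonneg fun i _ => hE i
  have hpoint : ∀ i, |Q i - (Q i + E i) / (1 + S)| ≤ E i + (Q i + E i) * (S / (1 + S)) := by
    intro i
    have hq := hQ.1 i
    have he := hE i
    have hnn : 0 ≤ (Q i + E i) * (S / (1 + S)) := by positivity
    have hsplit : Q i - (Q i + E i) / (1 + S) = -E i + (Q i + E i) * (S / (1 + S)) := by
      field_simp
      ring
    rw [hsplit, abs_le]
    constructor <;> linarith
  have hsum : ∑ i, |Q i - (Q i + E i) / (1 + S)| ≤ 2 * S := by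
    calc _ ≤ ∑ i, (E i + (Q i + E i) * (S / (1 + S))) := sum_le_sum fun i _ => hpoint i
      _ = S + (1 + S) * (S / (1 + S)) := by
          rw [sum_add_distrib, ← sum_mul, sum_add_distrib, hQ.2, ← hS]
      _ = 2 * S := by field_simp; ring
  rw [tv]
  linarith

theorem dist_expProp_le_weight_tau_witnesses {ℓ : ℕ} (α τ : ℝ) (hα : 0 < α) (hτ : 0 < τ)
    (Q : Fin ℓ → ℝ) (hQ : IsDist Q)
    (Wτ : Finset (Fin ℓ))
    (hW : Wτ = univ.filter (fun i : Fin ℓ => 0 < i.1 ∧ Q i > (1 + α + τ) * Q (pred' i))) :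
    ∃ Q' : Fin ℓ → ℝ, IsDist Q' ∧ ExpProp α Q' ∧
      tv Q Q' ≤ ((1 + α + τ) / (α + τ)) * (∑ i ∈ Wτ, Q i) + τ * (1 + α) / α ^ 2 := by
  have hE := expExcess_nonneg hα Q
  have hS0 : 0 ≤ ∑ j, expExcess α Q j := sum_nonneg fun i _ => hE i
  refine ⟨fun i => (Q i + expExcess α Q i) / (1 + ∑ j, expExcess α Q j), ⟨fun i => ?_, ?_⟩,
    fun i h => ?_, ?_⟩
  · have := hQ.1 i
    have := hE i
    positivity
  · rw [← sum_div, sum_add_distrib, hQ.2]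
    exact div_self (by positivity)
  · rw [← mul_div_assoc]
    exact div_le_div_of_nonneg_right (expProp_add_expExcess hα Q i h) (by positivity)
  · refine (tv_normalize_add_le hQ hE).trans ((sum_expExcess_le hα Q).trans ?_)
    have hdef := sum_expDefect_le hα hτ hQ.1
    rw [← hW, hQ.2, mul_one] at hdef
    have hw1 : ∑ i ∈ Wτ, Q i ≤ 1 :=
      hQ.2 ▸ sum_le_sum_of_subset_of_nonneg (subset_univ _) fun i _ _ => hQ.1 i
    have hw0 : 0 ≤ ∑ i ∈ Wτ, Q i := sum_nonneg fun i _ => hQ.1 i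
    set w := ∑ i ∈ Wτ, Q i
    have hfrac : w * (τ / (α * (α + τ))) ≤ τ / α ^ 2 := by
      calc w * (τ / (α * (α + τ))) ≤ 1 * (τ / (α * α)) := by gcongr; linarith
        _ = τ / α ^ 2 := by rw [one_mul, sq]
    calc (∑ j, expDefect α Q j) / α ≤ (w + τ) / α := by gcongr
      _ = w * (1 / (α + τ)) + w * (τ / (α * (α + τ))) + τ / α := by field_simp
      _ ≤ w * (1 / (α + τ)) + τ / α ^ 2 + τ / α + w := by linarith
      _ = _ := by field_simp; ring
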